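/- Let ρ = e^{2πi/3}. For every α > 0 and all a, t ∈ ℂ: A_{q³}^{(3α)}(a³; t³) = Σ_{j,k=0}^∞ ((a;q)_j (a;q)_k ρ^k q^{α(j+k)²} t^{j+k} / ((q;q)_j (q;q)_k)) · A_q^{(α)}(a; ρ² q^{2α(j+k)} t). Here A_{q³}^{(3α)}(a³; t³) = Σ_{n=0}^∞ (a³;q³)_n q^{9α n²} t^{3n}/(q³;q³)_n. -/

import Mathlib

open Complex

/-- The finite q-shifted factorial `(a;q)_n`. -/
noncomputable def qPoch (q a : ℂ) (n : ℕ) : ℂ := ∏ j ∈ Finset.range n, (1 - a * q ^ j)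

/-- The generalized Ramanujan function `A_q^{(α)}(a;t) = Σ_{n≥0} (a;q)_n q^{αn²} t^n/(q;q)_n`. -/
noncomputable def Aq (q α : ℝ) (a t : ℂ) : ℂ :=
  ∑' n : ℕ, qPoch (q : ℂ) a n * ((q ^ (α * (n : ℝ) ^ 2) : ℝ) : ℂ) * t ^ n / qPoch (q : ℂ) (q : ℂ) n

/-- The generating series `Σ (a;q)_n / (q;q)_n X^n`. -/
noncomputable def qBinomialSeries (q a : ℂ) : PowerSeries ℂ :=
  PowerSeries.mk fun n => qPoch q a n / qPoch q q n

lemma qPoch_zero (q a : ℂ) : qPoch q a 0 = 1 := by simp [qPoch]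

lemma qPoch_succ (q a : ℂ) (n : ℕ) : qPoch q a (n + 1) = qPoch q a n * (1 - a * q ^ n) := by
  simp [qPoch, Finset.prod_range_succ]

lemma one_sub_mul_pow_ne_zero {q : ℂ} (hq : ‖q‖ < 1) (n : ℕ) : 1 - q * q ^ n ≠ 0 := by
  intro h
  have h1 : q ^ (n + 1) = 1 := by rw [pow_succ']; exact (sub_eq_zero.mp h).symm
  have h2 : ‖q‖ ^ (n + 1) = 1 := by rw [← norm_pow, h1, norm_one]
  exact absurd h2 (pow_lt_one₀ (norm_nonneg q) hq n.succ_ne_zero).ne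

lemma qPoch_self_ne_zero {q : ℂ} (hq : ‖q‖ < 1) (n : ℕ) : qPoch q q n ≠ 0 :=
  Finset.prod_ne_zero_iff.mpr fun j _ => one_sub_mul_pow_ne_zero hq j

lemma qPoch_ratio_succ {q : ℂ} (hq : ‖q‖ < 1) (a : ℂ) (n : ℕ) :
    qPoch q a (n + 1) / qPoch q q (n + 1) * (1 - q ^ (n + 1)) =
      qPoch q a n / qPoch q q n * (1 - a * q ^ n) := by
  have h2 := one_sub_mul_pow_ne_zero hq n
  rw [qPoch_succ, qPoch_succ, pow_succ', mul_div_mul_comm, mul_assoc, div_mul_cancel₀ _ h2]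

lemma qBinomialSeries_functional_equation {q : ℂ} (hq : ‖q‖ < 1) (a : ℂ) :
    (1 - PowerSeries.X) * qBinomialSeries q a =
      (1 - PowerSeries.C a * PowerSeries.X) * PowerSeries.rescale q (qBinomialSeries q a) := by
  ext n
  cases n with
  | zero =>
    simp only [sub_mul, one_mul, map_sub, mul_assoc, PowerSeries.coeff_zero_X_mul,
      PowerSeries.coeff_C_mul, PowerSeries.coeff_rescale, pow_zero, mul_zero]
  | succ n =>
    have h := qPoch_ratio_succ hq a n
    simp only [sub_mul, one_mul, map_sub, mul_assoc, PowerSeries.coeff_succ_X_mul,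
      PowerSeries.coeff_C_mul, PowerSeries.coeff_rescale, qBinomialSeries, PowerSeries.coeff_mk]
    linear_combination h

/-- The product of the series `qBinomialSeries` at `X`, `ρ X`, `ρ² X`. -/
noncomputable def qBinomialCubic (q a ρ : ℂ) : PowerSeries ℂ :=
  qBinomialSeries q a * PowerSeries.rescale ρ (qBinomialSeries q a) *
    PowerSeries.rescale (ρ ^ 2) (qBinomialSeries q a)

lemma qBinomialCubic_functional_equation {q : ℂ} (hq : ‖q‖ < 1) (a : ℂ) {ρ : ℂ}
    (hρ : 1 + ρ + ρ ^ 2 = 0) :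
    (1 - PowerSeries.X ^ 3) * qBinomialCubic q a ρ =
      (1 - PowerSeries.C (a ^ 3) * PowerSeries.X ^ 3) *
        PowerSeries.rescale q (qBinomialCubic q a ρ) := by
  have h0 := qBinomialSeries_functional_equation hq a
  have key : ∀ c : ℂ, (1 - PowerSeries.C c * PowerSeries.X) *
      PowerSeries.rescale c (qBinomialSeries q a) =
      (1 - PowerSeries.C a * PowerSeries.C c * PowerSeries.X) *
        PowerSeries.rescale q (PowerSeries.rescale c (qBinomialSeries q a)) := by
    intro c
    have h := congrArg (PowerSeries.rescale c) h0
    have hC : PowerSeries.rescale c (PowerSeries.C a) = PowerSeries.C a := by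
      ext n
      rw [PowerSeries.coeff_rescale, PowerSeries.coeff_C]
      split_ifs with hn <;> simp [hn]
    rw [map_mul, map_mul, map_sub, map_sub, map_mul, map_one, PowerSeries.rescale_X, hC,
      PowerSeries.rescale_rescale, mul_comm q c, ← PowerSeries.rescale_rescale] at h
    rw [h]
    ring
  have h1 := key ρ
  have h2 := key (ρ ^ 2)
  have hR : 1 + PowerSeries.C ρ + PowerSeries.C ρ ^ 2 = (0 : PowerSeries ℂ) := by
    rw [← map_pow, ← map_one (PowerSeries.C (R := ℂ)), ← map_add, ← map_add, hρ, map_zero]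
  have hprod : ∀ x : PowerSeries ℂ, (1 - x) * (1 - PowerSeries.C ρ * x) *
      (1 - PowerSeries.C ρ ^ 2 * x) = 1 - x ^ 3 := by
    intro x
    linear_combination (-x + x ^ 2 * PowerSeries.C ρ - x ^ 3 * (PowerSeries.C ρ - 1)) * hR
  have hX := hprod PowerSeries.X
  have haX := hprod (PowerSeries.C a * PowerSeries.X)
  rw [map_pow] at h2
  rw [map_pow, ← mul_pow, ← hX, ← haX, qBinomialCubic, map_mul, map_mul]
  calc _ = ((1 - PowerSeries.X) * qBinomialSeries q a) *
        ((1 - PowerSeries.C ρ * PowerSeries.X) *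
          PowerSeries.rescale ρ (qBinomialSeries q a)) *
        ((1 - PowerSeries.C ρ ^ 2 * PowerSeries.X) *
          PowerSeries.rescale (ρ ^ 2) (qBinomialSeries q a)) := by ring
    _ = _ := by rw [h0, h1, h2]; ring

lemma qBinomialCubic_coeff_mul {q : ℂ} (hq : ‖q‖ < 1) (a : ℂ) {ρ : ℂ}
    (hρ : 1 + ρ + ρ ^ 2 = 0) (n : ℕ) :
    PowerSeries.coeff n (qBinomialCubic q a ρ) * (1 - q ^ n) =
      if 3 ≤ n then PowerSeries.coeff (n - 3) (qBinomialCubic q a ρ) *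
        (1 - a ^ 3 * q ^ (n - 3)) else 0 := by
  have h := congrArg (PowerSeries.coeff n) (qBinomialCubic_functional_equation hq a hρ)
  simp only [sub_mul, one_mul, map_sub, mul_assoc, PowerSeries.coeff_C_mul,
    PowerSeries.coeff_X_pow_mul', PowerSeries.coeff_rescale] at h
  split_ifs at h ⊢ with hn <;> linear_combination h

lemma qBinomialCubic_coeff_zero (q a ρ : ℂ) :
    PowerSeries.coeff 0 (qBinomialCubic q a ρ) = 1 := by
  simp [qBinomialCubic, qBinomialSeries, qPoch_zero, PowerSeries.coeff_mul]

lemma qBinomialCubic_coeff_three_mul {q : ℂ} (hq : ‖q‖ < 1) (a : ℂ) {ρ : ℂ}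
    (hρ : 1 + ρ + ρ ^ 2 = 0) (n : ℕ) :
    PowerSeries.coeff (3 * n) (qBinomialCubic q a ρ) =
      qPoch (q ^ 3) (a ^ 3) n / qPoch (q ^ 3) (q ^ 3) n := by
  have hq3 : ‖q ^ 3‖ < 1 := by
    rw [norm_pow]; exact pow_lt_one₀ (norm_nonneg q) hq three_ne_zero
  induction n with
  | zero => simp [qBinomialCubic_coeff_zero, qPoch_zero]
  | succ n ih =>
    have h := qBinomialCubic_coeff_mul hq a hρ (3 * (n + 1))
    rw [if_pos (by lia), show 3 * (n + 1) - 3 = 3 * n by lia, ih, pow_mul, pow_mul,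
      ← qPoch_ratio_succ hq3] at h
    refine mul_right_cancel₀ ?_ h
    rw [pow_succ']
    exact one_sub_mul_pow_ne_zero hq3 n

lemma qBinomialCubic_coeff_eq_zero {q : ℂ} (hq : ‖q‖ < 1) (a : ℂ) {ρ : ℂ}
    (hρ : 1 + ρ + ρ ^ 2 = 0) (n : ℕ) (hn : ¬ 3 ∣ n) :
    PowerSeries.coeff n (qBinomialCubic q a ρ) = 0 := by
  induction n using Nat.strong_induction_on with
  | _ n ih =>
    have h := qBinomialCubic_coeff_mul hq a hρ n
    obtain ⟨m, rfl⟩ : ∃ m, n = m + 1 := Nat.exists_eq_succ_of_ne_zero (by rintro rfl; simp at hn)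
    have hne : 1 - q ^ (m + 1) ≠ 0 := by
      rw [pow_succ']; exact one_sub_mul_pow_ne_zero hq m
    refine (mul_eq_zero.mp (h.trans ?_)).resolve_right hne
    split_ifs with h3
    · rw [ih (m + 1 - 3) (by lia) (by lia), zero_mul]
    · rfl

lemma norm_qPoch_ratio_le {q : ℂ} (hq : ‖q‖ < 1) (a : ℂ) (n : ℕ) :
    ‖qPoch q a n / qPoch q q n‖ ≤ ((1 + ‖a‖) / (1 - ‖q‖)) ^ n := by
  rw [qPoch, qPoch, ← Finset.prod_div_distrib]
  refine (Finset.norm_prod_le _ _).trans ?_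
  rw [← Finset.card_range n, ← Finset.prod_const, Finset.card_range]
  refine Finset.prod_le_prod (fun _ _ => norm_nonneg _) fun j _ => ?_
  have hj : ‖q‖ ^ j ≤ 1 := pow_le_one₀ (norm_nonneg q) hq.le
  rw [norm_div]
  have hpos : 0 < 1 - ‖q‖ := sub_pos.mpr hq
  gcongr
  · refine (norm_sub_le _ _).trans ?_
    rw [norm_one, norm_mul, norm_pow]
    gcongr
    exact mul_le_of_le_one_right (norm_nonneg a) hj
  · have h := norm_sub_norm_le (1 : ℂ) (q * q ^ j)
    rw [norm_one, norm_mul, norm_pow] at h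
    linarith [mul_le_of_le_one_right (norm_nonneg q) hj]

lemma exists_gaussian_bound {r : ℝ} (hr0 : 0 < r) (hr1 : r < 1) {M : ℝ} (hM : 1 ≤ M) :
    ∃ C, ∀ n : ℕ, r ^ (n ^ 2) * M ^ n ≤ C := by
  obtain ⟨N, hN⟩ := exists_pow_lt_of_lt_one (inv_pos.mpr (by positivity : 0 < M)) hr1
  refine ⟨M ^ N, fun n => ?_⟩
  have hMN : 1 ≤ M ^ N := one_le_pow₀ hM
  rcases le_total n N with h | h
  · calc r ^ (n ^ 2) * M ^ n ≤ 1 * M ^ N := by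
          gcongr
          exact pow_le_one₀ hr0.le hr1.le
      _ = M ^ N := one_mul _
  · rw [sq, pow_mul, ← mul_pow]
    refine (pow_le_one₀ (by positivity) ?_).trans hMN
    calc r ^ n * M ≤ M⁻¹ * M := by
          gcongr
          exact (pow_le_pow_of_le_one hr0.le hr1.le h).trans hN.le
      _ = 1 := inv_mul_cancel₀ (by positivity)

/-- The general term of the triple series, with an arbitrary weight `w` in the total degree. -/
noncomputable def cubicTerm (q a ρ : ℂ) (w : ℕ → ℂ) (x : (ℕ × ℕ) × ℕ) : ℂ :=
  qPoch q a x.1.1 / qPoch q q x.1.1 * (ρ ^ x.1.2 * (qPoch q a x.1.2 / qPoch q q x.1.2)) *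
    ((ρ ^ 2) ^ x.2 * (qPoch q a x.2 / qPoch q q x.2)) * w (x.1.1 + x.1.2 + x.2)

lemma summable_cubicTerm {q : ℂ} (hq : ‖q‖ < 1) (a : ℂ) {ρ : ℂ} (hρ : ‖ρ‖ = 1)
    {r : ℝ} (hr0 : 0 < r) (hr1 : r < 1) {w : ℕ → ℂ} {T : ℝ} (hT : 0 ≤ T)
    (hw : ∀ n, ‖w n‖ ≤ r ^ (n ^ 2) * T ^ n) : Summable (cubicTerm q a ρ w) := by
  set K : ℝ := (1 + ‖a‖) / (1 - ‖q‖) with hK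
  have hK0 : 0 ≤ K := div_nonneg (by positivity) (sub_nonneg.mpr hq.le)
  obtain ⟨C, hC⟩ := exists_gaussian_bound hr0 hr1 (M := 2 * K * T + 1)
    (le_add_of_nonneg_left (by positivity))
  have hgeo : Summable fun n : ℕ => (1 / 2 : ℝ) ^ n := summable_geometric_two
  have hnn : ∀ n : ℕ, (0 : ℝ) ≤ (1 / 2) ^ n := fun n => by positivity
  have hsum := (((hgeo.mul_of_nonneg hgeo hnn hnn).mul_of_nonneg hgeo
    (fun x => mul_nonneg (hnn _) (hnn _)) hnn).mul_left C)
  refine Summable.of_norm_bounded hsum fun x => ?_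
  obtain ⟨⟨i, j⟩, k⟩ := x
  have hbound := norm_qPoch_ratio_le hq a
  simp only [cubicTerm, norm_mul, norm_pow, hρ, one_pow, one_mul]
  calc _ ≤ K ^ i * K ^ j * K ^ k * (r ^ ((i + j + k) ^ 2) * T ^ (i + j + k)) := by
        gcongr
        · exact hbound i
        · exact hbound j
        · exact hbound k
        · exact hw _
    _ = (r ^ ((i + j + k) ^ 2) * (2 * K * T) ^ (i + j + k)) * (1 / 2) ^ (i + j + k) := by
        rw [mul_assoc 2, mul_pow 2, one_div, inv_pow, mul_pow]
        field_simp
        ring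
    _ ≤ C * (1 / 2) ^ (i + j + k) := by
        gcongr
        refine le_trans ?_ (hC (i + j + k))
        gcongr
        linarith
    _ = _ := by rw [pow_add, pow_add]

lemma tsum_cubicTerm {q a ρ : ℂ} {w : ℕ → ℂ} (hs : Summable (cubicTerm q a ρ w)) :
    ∑' x, cubicTerm q a ρ w x = ∑' n, PowerSeries.coeff n (qBinomialCubic q a ρ) * w n := by
  refine ((hs.hasSum.tsum_fiberwise fun x => x.1.1 + x.1.2 + x.2).tsum_eq.symm).trans ?_
  refine tsum_congr fun n => ?_
  set S : Finset ((ℕ × ℕ) × ℕ) :=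
    ((Finset.HasAntidiagonal.antidiagonal n).sigma fun y : ℕ × ℕ =>
      Finset.HasAntidiagonal.antidiagonal y.1).image
      fun z => (z.2, z.1.2) with hS
  have hfiber : (fun x : (ℕ × ℕ) × ℕ => x.1.1 + x.1.2 + x.2) ⁻¹' {n} = (S : Set _) := by
    ext ⟨⟨i, j⟩, k⟩
    simp [hS]
  rw [hfiber, Finset.tsum_subtype' S (cubicTerm q a ρ w), hS, Finset.sum_image,
    Finset.sum_sigma, qBinomialCubic, PowerSeries.coeff_mul, Finset.sum_mul]
  · refine Finset.sum_congr rfl fun y hy => ?_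
    rw [PowerSeries.coeff_mul, Finset.sum_mul, Finset.sum_mul]
    refine Finset.sum_congr rfl fun z hz => ?_
    rw [Finset.HasAntidiagonal.mem_antidiagonal] at hy hz
    simp only [cubicTerm, qBinomialSeries, PowerSeries.coeff_rescale, PowerSeries.coeff_mk]
    rw [hz, hy]
  · rintro ⟨⟨y1, y2⟩, z⟩ hy ⟨⟨y1', y2'⟩, z'⟩ hy' h
    simp only [Finset.coe_sigma, Set.mem_sigma_iff, Finset.mem_coe,
      Finset.HasAntidiagonal.mem_antidiagonal] at hy hy'
    obtain ⟨rfl, rfl⟩ := Prod.mk.inj h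
    obtain rfl : y1 = y1' := hy.2.symm.trans hy'.2
    rfl

lemma tsum_qBinomialCubic {q : ℂ} (hq : ‖q‖ < 1) (a : ℂ) {ρ : ℂ} (hρ : 1 + ρ + ρ ^ 2 = 0)
    (w : ℕ → ℂ) :
    ∑' n, PowerSeries.coeff n (qBinomialCubic q a ρ) * w n =
      ∑' n, qPoch (q ^ 3) (a ^ 3) n / qPoch (q ^ 3) (q ^ 3) n * w (3 * n) := by
  have hinj : Function.Injective fun n : ℕ => 3 * n := fun m n h => by simpa using h
  rw [← hinj.tsum_eq]
  · exact tsum_congr fun n => by rw [qBinomialCubic_coeff_three_mul hq a hρ]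
  · intro n hn
    by_contra h
    refine hn ?_
    change PowerSeries.coeff n (qBinomialCubic q a ρ) * w n = 0
    rw [qBinomialCubic_coeff_eq_zero hq a hρ n fun ⟨m, hm⟩ => h ⟨m, hm.symm⟩, zero_mul]

/-- with `ρ = e^{2πi/3}`,
`A_{q³}^{(3α)}(a³;t³) = Σ_{j,k≥0} ((a;q)_j (a;q)_k ρ^k q^{α(j+k)²} t^{j+k}/((q;q)_j (q;q)_k))
  · A_q^{(α)}(a;ρ² q^{2α(j+k)} t)`,
where `A_{q³}^{(3α)}(a³;t³) = Σ_{n≥0} (a³;q³)_n q^{9αn²} t^{3n}/(q³;q³)_n`. -/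
theorem Aq_cubic_expansion (q : ℝ) (hq0 : 0 < q) (hq1 : q < 1) (α : ℝ) (hα : 0 < α)
    (a t : ℂ) :
    ∑' n : ℕ, qPoch ((q : ℂ) ^ 3) (a ^ 3) n * ((q ^ (9 * α * (n : ℝ) ^ 2) : ℝ) : ℂ) *
        t ^ (3 * n) / qPoch ((q : ℂ) ^ 3) ((q : ℂ) ^ 3) n
    = ∑' p : ℕ × ℕ,
        (qPoch (q : ℂ) a p.1 * qPoch (q : ℂ) a p.2 *
            Complex.exp (2 * Real.pi * Complex.I / 3) ^ p.2 *
            ((q ^ (α * ((p.1 : ℝ) + (p.2 : ℝ)) ^ 2) : ℝ) : ℂ) * t ^ (p.1 + p.2) /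
          (qPoch (q : ℂ) (q : ℂ) p.1 * qPoch (q : ℂ) (q : ℂ) p.2)) *
          Aq q α a (Complex.exp (2 * Real.pi * Complex.I / 3) ^ 2 *
            ((q ^ (2 * α * ((p.1 : ℝ) + (p.2 : ℝ))) : ℝ) : ℂ) * t) := by
  set ρ : ℂ := Complex.exp (2 * Real.pi * Complex.I / 3) with hρdef
  have hprim : IsPrimitiveRoot ρ 3 := by
    have h := Complex.isPrimitiveRoot_exp 3 three_ne_zero
    rwa [Nat.cast_ofNat] at h
  have hρ : 1 + ρ + ρ ^ 2 = 0 := by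
    have h := hprim.geom_sum_eq_zero (by norm_num)
    simpa [Finset.sum_range_succ] using h
  have hρn : ‖ρ‖ = 1 := hprim.norm'_eq_one three_ne_zero
  have hq : ‖(q : ℂ)‖ < 1 := by rwa [Complex.norm_real, Real.norm_of_nonneg hq0.le]
  have hr0 : 0 < q ^ α := Real.rpow_pos_of_pos hq0 α
  have hr1 : q ^ α < 1 := Real.rpow_lt_one hq0.le hq1 hα
  set w : ℕ → ℂ := fun n => ((q ^ (α * (n : ℝ) ^ 2) : ℝ) : ℂ) * t ^ n with hw
  have hwb : ∀ n, ‖w n‖ ≤ (q ^ α) ^ (n ^ 2) * ‖t‖ ^ n := fun n => by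
    rw [hw, norm_mul, norm_pow, Complex.norm_real, Real.norm_of_nonneg (by positivity),
      Real.rpow_mul hq0.le, ← Nat.cast_pow, Real.rpow_natCast]
  have hs := summable_cubicTerm hq a hρn hr0 hr1 (norm_nonneg t) hwb
  calc _ = ∑' n, qPoch ((q : ℂ) ^ 3) (a ^ 3) n / qPoch ((q : ℂ) ^ 3) ((q : ℂ) ^ 3) n *
        w (3 * n) := by
        refine tsum_congr fun n => ?_
        simp only [hw]
        rw [show α * ((3 * n : ℕ) : ℝ) ^ 2 = 9 * α * (n : ℝ) ^ 2 by push_cast; ring]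
        ring
    _ = ∑' p : ℕ × ℕ, ∑' m : ℕ, cubicTerm q a ρ w (p, m) := by
        rw [← tsum_qBinomialCubic hq a hρ w, ← tsum_cubicTerm hs, hs.tsum_prod]
    _ = _ := by
        refine tsum_congr fun p => ?_
        rw [Aq, ← tsum_mul_left]
        refine tsum_congr fun m => ?_
        have hexp : q ^ (α * ((p.1 + p.2 + m : ℕ) : ℝ) ^ 2) =
            q ^ (α * ((p.1 : ℝ) + (p.2 : ℝ)) ^ 2) * q ^ (α * (m : ℝ) ^ 2) *
              (q ^ (2 * α * ((p.1 : ℝ) + (p.2 : ℝ)))) ^ m := by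
          rw [← Real.rpow_mul_natCast hq0.le, ← Real.rpow_add hq0,
            ← Real.rpow_add hq0]
          congr 1
          push_cast
          ring
        simp only [cubicTerm, hw]
        rw [hexp]
        push_cast
        ring
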